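/- Let f(θ, x) be differentiable and λ-strongly concave in x on a convex set 𝒳, and suppose ‖∇_x f(θ₁, x) - ∇_x f(θ₂, x)‖ ≤ L_{xθ}‖θ₁ - θ₂‖ for all x. Then the maximizer map x⋆(θ) = argmax_{x∈𝒳} f(θ, x) is well-defined and satisfies ‖x⋆(θ₁) - x⋆(θ₂)‖ ≤ (L_{xθ}/λ)‖θ₁ - θ₂‖. -/

import Mathlib

open Set

lemma deriv_lower_aux (φ : ℝ → ℝ) (m a k : ℝ) (hφ : HasDerivAt φ m 0)
    (h : ∀ t : ℝ, 0 < t → t < 1 → t * (a + (1 - t) * k) ≤ φ t - φ 0) : a + k ≤ m := by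
  have h1 := hφ.tendsto_slope_zero_right
  have h2 : Filter.Tendsto (fun t : ℝ => a + (1 - t) * k) (nhdsWithin 0 (Ioi 0))
      (nhds (a + k)) := by
    have : ContinuousAt (fun t : ℝ => a + (1 - t) * k) 0 := by fun_prop
    have h3 := this.tendsto
    simp only [sub_zero, one_mul] at h3
    exact h3.mono_left nhdsWithin_le_nhds
  refine le_of_tendsto_of_tendsto h2 h1 ?_
  filter_upwards [Ioo_mem_nhdsGT (zero_lt_one (α := ℝ))] with t ht
  have := h t ht.1 ht.2
  rw [zero_add, smul_eq_mul, inv_mul_eq_div, le_div_iff₀ ht.1]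
  linarith

lemma strong_concave_line {E : Type*} [NormedAddCommGroup E] [InnerProductSpace ℝ E]
    {s : Set E} {g : E → ℝ} {lam : ℝ} (hg : StrongConcaveOn s lam g) {x y : E}
    (hx : x ∈ s) (hy : y ∈ s) (t : ℝ) (h0 : 0 < t) (h1 : t < 1) :
    x + t • (y - x) ∈ s ∧
    t * ((g y - g x) + (1 - t) * (lam / 2 * ‖x - y‖ ^ 2)) ≤ g (x + t • (y - x)) - g x := by
  have e : x + t • (y - x) = (1 - t) • x + t • y := by module
  have := hg.2 hx hy (sub_nonneg.2 h1.le) h0.le (by ring)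
  rw [e]
  refine ⟨hg.1 hx hy (sub_nonneg.2 h1.le) h0.le (by ring), ?_⟩
  simp only [smul_eq_mul] at this
  linarith

lemma max_growth {E : Type*} [NormedAddCommGroup E] [InnerProductSpace ℝ E]
    {s : Set E} {g : E → ℝ} {lam : ℝ} (hg : StrongConcaveOn s lam g) {x y : E}
    (hx : x ∈ s) (hy : y ∈ s) (hm : IsMaxOn g s x) :
    (g y - g x) + lam / 2 * ‖x - y‖ ^ 2 ≤ 0 := by
  refine deriv_lower_aux (fun _ => 0) 0 _ _ (hasDerivAt_const _ _) fun t h0 h1 => ?_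
  obtain ⟨h2, h3⟩ := strong_concave_line hg hx hy t h0 h1
  have : g (x + t • (y - x)) ≤ g x := hm h2
  linarith

lemma line_deriv {E : Type*} [NormedAddCommGroup E] [InnerProductSpace ℝ E] [CompleteSpace E]
    {g : E → ℝ} (hd : Differentiable ℝ g) (x v : E) :
    HasDerivAt (fun t : ℝ => g (x + t • v)) (inner ℝ (gradient g x) v) 0 := by
  have h1 : HasDerivAt (fun t : ℝ => x + t • v) v 0 := by
    simpa using ((hasDerivAt_id (0 : ℝ)).smul_const v).const_add x
  have h2 : HasFDerivAt g (InnerProductSpace.toDual ℝ E (gradient g x)) (x + (0 : ℝ) • v) := by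
    simpa using (hd x).hasGradientAt.hasFDerivAt
  exact h2.comp_hasDerivAt (0 : ℝ) h1

/-- if `f(θ, ·)` is differentiable and `λ`-strongly concave on a
convex set `𝒳` and `∇_x f(·, x)` is `L_{xθ}`-Lipschitz in `θ` uniformly in `x`,
then the maximizer map `θ ↦ x⋆(θ)` is `(L_{xθ}/λ)`-Lipschitz. -/
theorem argmax_lipschitz
    {d : ℕ} {Θ : Type*} [NormedAddCommGroup Θ] [NormedSpace ℝ Θ]
    (f : Θ → EuclideanSpace ℝ (Fin d) → ℝ)
    (𝒳 : Set (EuclideanSpace ℝ (Fin d))) (h𝒳 : Convex ℝ 𝒳)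
    (hclosed : IsClosed 𝒳) (hne : 𝒳.Nonempty)
    (lam Lxθ : ℝ) (hlam : 0 < lam)
    (hconc : ∀ θ, StrongConcaveOn 𝒳 lam (f θ))
    (hdiff : ∀ θ, Differentiable ℝ (f θ))
    (hLip : ∀ x, ∀ θ₁ θ₂,
      ‖gradient (fun y => f θ₁ y) x - gradient (fun y => f θ₂ y) x‖ ≤
        Lxθ * ‖θ₁ - θ₂‖)
    (xstar : Θ → EuclideanSpace ℝ (Fin d))
    (hmem : ∀ θ, xstar θ ∈ 𝒳)
    (hmax : ∀ θ, IsMaxOn (f θ) 𝒳 (xstar θ)) :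
    -- the maximizer is unique ...
    (∀ θ x, x ∈ 𝒳 → IsMaxOn (f θ) 𝒳 x → x = xstar θ) ∧
    -- ... and `(L_{xθ}/λ)`-Lipschitz in `θ`
    ∀ θ₁ θ₂, ‖xstar θ₁ - xstar θ₂‖ ≤ Lxθ / lam * ‖θ₁ - θ₂‖ := by
  constructor
  · intro θ x hx hm
    have h1 := max_growth (hconc θ) hx (hmem θ) hm
    have h2 : f θ x ≤ f θ (xstar θ) := hmax θ hx
    have h3 : lam * ‖x - xstar θ‖ ^ 2 ≤ 0 := by linarith
    have h4 : ‖x - xstar θ‖ ^ 2 = 0 :=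
      le_antisymm (nonpos_of_mul_nonpos_right h3 hlam) (sq_nonneg _)
    exact sub_eq_zero.1 (norm_eq_zero.1 (pow_eq_zero_iff two_ne_zero |>.1 h4))
  · intro θ₁ θ₂
    have hL := hLip (xstar θ₁) θ₁ θ₂
    have m1 := hmem θ₁
    have m2 := hmem θ₂
    have M1 := hmax θ₁
    have h1 := max_growth (hconc θ₂) m2 m1 (hmax θ₂)
    generalize xstar θ₁ = x at *
    generalize xstar θ₂ = y at *
    have h2 := deriv_lower_aux _ _ (f θ₂ y - f θ₂ x) (lam / 2 * ‖x - y‖ ^ 2)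
      (line_deriv (hdiff θ₂) x (y - x)) (fun t h0 h1 => by
        simpa using (strong_concave_line (hconc θ₂) m1 m2 t h0 h1).2)
    have h3 := deriv_lower_aux _ _ 0 0
      (line_deriv (hdiff θ₁) x (y - x)).neg (fun t h0 h1 => by
        have : f θ₁ (x + t • (y - x)) ≤ f θ₁ x :=
          M1 (strong_concave_line (hconc θ₁) m1 m2 t h0 h1).1
        simpa using this)
    have h4 := real_inner_le_norm (gradient (f θ₁) x - gradient (f θ₂) x) (x - y)
    have h5 : inner ℝ (gradient (f θ₁) x - gradient (f θ₂) x) (x - y) =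
        inner ℝ (gradient (f θ₂) x) (y - x) - inner ℝ (gradient (f θ₁) x) (y - x) := by
      simp only [inner_sub_left, inner_sub_right]
      ring
    rw [norm_sub_rev y x] at h1
    change ‖gradient (f θ₁) x - gradient (f θ₂) x‖ ≤ _ at hL
    have h6 : lam * ‖x - y‖ ^ 2 ≤ Lxθ * ‖θ₁ - θ₂‖ * ‖x - y‖ := by
      have := mul_le_mul_of_nonneg_right hL (norm_nonneg (x - y))
      linarith
    have h7 : 0 ≤ Lxθ * ‖θ₁ - θ₂‖ := (norm_nonneg _).trans hL
    rw [div_mul_eq_mul_div, le_div_iff₀ hlam]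
    rcases (norm_nonneg (x - y)).eq_or_lt with h | h
    · rw [← h]; simpa using h7
    · refine le_of_mul_le_mul_right ?_ h
      linarith
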